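/- If A and B are RFD *-algebras over ℂ, then their coproduct A * B in the category of unital *-algebras is RFD. -/

import Mathlib

/-- A *-algebra over ℂ is RFD if *-homomorphisms into matrix algebras separate its points. -/
def IsRFD (A : Type) [Ring A] [Algebra ℂ A] [StarRing A] [StarModule ℂ A] : Prop :=
  ∀ a : A, a ≠ 0 → ∃ (n : ℕ) (π : A →⋆ₐ[ℂ] Matrix (Fin n) (Fin n) ℂ), π a ≠ 0

/-- `C` together with `ia`, `ib` is a coproduct (free product) of the unital complex
*-algebras `A` and `B` in the category of unital *-algebras. -/
def IsStarAlgCoproduct {A B C : Type}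
    [Ring A] [Algebra ℂ A] [StarRing A] [StarModule ℂ A]
    [Ring B] [Algebra ℂ B] [StarRing B] [StarModule ℂ B]
    [Ring C] [Algebra ℂ C] [StarRing C] [StarModule ℂ C]
    (ia : A →⋆ₐ[ℂ] C) (ib : B →⋆ₐ[ℂ] C) : Prop :=
  ∀ (D : Type) [Ring D] [Algebra ℂ D] [StarRing D] [StarModule ℂ D]
    (f : A →⋆ₐ[ℂ] D) (g : B →⋆ₐ[ℂ] D),
    ∃! h : C →⋆ₐ[ℂ] D, h.comp ia = f ∧ h.comp ib = g

/-! ### Matrices acting on one coordinate of a finite state space -/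

/-- A coordinate with values in `K` on a state space `X`: every state has a label in `K`, which can
be overwritten without affecting the remaining data. -/
structure StateCoord (X K : Type) where
  /-- The current value of the coordinate. -/
  label : X → K
  /-- Overwrite the value of the coordinate. -/
  upd : X → K → X
  label_upd : ∀ x i, label (upd x i) = i
  upd_upd : ∀ x i j, upd (upd x i) j = upd x j
  upd_label : ∀ x, upd x (label x) = x

namespace StateCoord

variable {X K : Type}

theorem upd_label_eq_iff (s : StateCoord X K) (x y : X) :
    s.upd x (s.label y) = y ↔ s.upd y (s.label x) = x := by
  constructor
  · intro h
    rw [← h, s.upd_upd, s.upd_label]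
  · intro h
    rw [← h, s.upd_upd, s.upd_label]

variable [DecidableEq X] [Fintype K]

/-- The matrix on `X` obtained by letting `m` act on a coordinate. -/
def ampl (s : StateCoord X K) (m : Matrix K K ℂ) : Matrix X X ℂ :=
  fun x y => ∑ i, if s.upd x i = y then m (s.label x) i else 0

theorem ampl_mulVec [Fintype X] (s : StateCoord X K) (m : Matrix K K ℂ) (u : X → ℂ) (x : X) :
    (s.ampl m).mulVec u x = ∑ i, m (s.label x) i * u (s.upd x i) := by
  simp only [Matrix.mulVec, dotProduct, ampl, Finset.sum_mul]
  rw [Finset.sum_comm]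
  simp [ite_mul]

theorem ampl_apply (s : StateCoord X K) (m : Matrix K K ℂ) (x y : X) :
    s.ampl m x y = if s.upd x (s.label y) = y then m (s.label x) (s.label y) else 0 := by
  unfold ampl
  rw [Finset.sum_eq_single (s.label y)]
  · intro i _ hi
    rw [if_neg]
    rintro rfl
    exact hi (s.label_upd x i).symm
  · simp

variable [Fintype X] [DecidableEq K]

/-- Letting matrices act on a coordinate is a *-homomorphism. -/
def amplHom (s : StateCoord X K) : Matrix K K ℂ →⋆ₐ[ℂ] Matrix X X ℂ where
  toFun := s.ampl
  map_one' := by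
    refine Matrix.ext_of_mulVec_single fun j => funext fun x => ?_
    simp only [ampl_mulVec, Matrix.one_apply, ite_mul, one_mul, zero_mul, Matrix.one_mulVec]
    rw [Finset.sum_ite_eq, if_pos (Finset.mem_univ _), s.upd_label]
  map_mul' a b := by
    refine Matrix.ext_of_mulVec_single fun j => funext fun x => ?_
    rw [← Matrix.mulVec_mulVec]
    simp only [ampl_mulVec, s.label_upd, s.upd_upd, Matrix.mul_apply, Finset.sum_mul,
      Finset.mul_sum, mul_assoc]
    exact Finset.sum_comm
  map_zero' := by
    ext x y
    simp [ampl]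
  map_add' a b := by
    ext x y
    simp only [ampl_apply, Matrix.add_apply]
    split_ifs <;> simp
  commutes' r := by
    refine Matrix.ext_of_mulVec_single fun j => funext fun x => ?_
    rw [ampl_mulVec, Finset.sum_eq_single (s.label x)]
    · simp [Matrix.algebraMap_eq_diagonal, s.upd_label, Pi.single_apply]
    · intro i _ hi
      simp [Matrix.algebraMap_eq_diagonal, hi.symm]
    · simp
  map_star' a := by
    ext x y
    simp only [Matrix.star_apply, ampl_apply, s.upd_label_eq_iff x y]
    split_ifs <;> simp

theorem amplHom_mulVec (s : StateCoord X K) (m : Matrix K K ℂ) (u : X → ℂ) (x : X) :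
    (s.amplHom m).mulVec u x = ∑ i, m (s.label x) i * u (s.upd x i) :=
  s.ampl_mulVec m u x

end StateCoord

/-! ### Levels of words -/

section Level

variable {K : Type} [DecidableEq K]

/-- One more than the last position at which `f` differs from `k₀` (capped by `n`), or `0`. -/
def wordLevel (n : ℕ) (k₀ : K) (f : Fin (n + 1) → K) : ℕ :=
  Finset.univ.sup fun i => if f i = k₀ then 0 else min ((i : ℕ) + 1) n

theorem wordLevel_le_iff {n : ℕ} {k₀ : K} {f : Fin (n + 1) → K} {m : ℕ} :
    wordLevel n k₀ f ≤ m ↔ ∀ i, f i ≠ k₀ → min ((i : ℕ) + 1) n ≤ m := by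
  simp only [wordLevel, Finset.sup_le_iff, Finset.mem_univ, true_implies]
  refine forall_congr' fun i => ?_
  by_cases h : f i = k₀ <;> simp [h]

theorem wordLevel_const (n : ℕ) (k₀ : K) : wordLevel n k₀ (fun _ => k₀) = 0 := by
  simp [wordLevel]

theorem wordLevel_lt_succ (n : ℕ) (k₀ : K) (f : Fin (n + 1) → K) : wordLevel n k₀ f < n + 1 :=
  Nat.lt_succ_of_le (wordLevel_le_iff.2 fun _ _ => min_le_right _ _)

theorem wordLevel_update_le (n : ℕ) (k₀ : K) (f : Fin (n + 1) → K) (j : Fin (n + 1)) (k : K) :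
    wordLevel n k₀ (Function.update f j k) ≤ max (wordLevel n k₀ f) (j + 1) := by
  rw [wordLevel_le_iff]
  intro i hi
  by_cases hij : i = j
  · subst hij
    exact le_max_of_le_right (min_le_left _ _)
  · rw [Function.update_of_ne hij] at hi
    exact le_max_of_le_left (wordLevel_le_iff.1 le_rfl i hi)

theorem eq_of_wordLevel_le {n : ℕ} {k₀ : K} {f : Fin (n + 1) → K} {j : Fin (n + 1)}
    (hj : (j : ℕ) < n) (hf : wordLevel n k₀ f ≤ j) : f j = k₀ := by
  by_contra h
  have := wordLevel_le_iff.1 hf j h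
  omega

theorem lt_wordLevel_update {n : ℕ} {k₀ : K} (f : Fin (n + 1) → K) {j : Fin (n + 1)} {k : K}
    (hj : (j : ℕ) < n) (hk : k ≠ k₀) : (j : ℕ) < wordLevel n k₀ (Function.update f j k) := by
  by_contra! h
  exact hk (by simpa using eq_of_wordLevel_le hj h)

end Level

/-- A coordinate whose position is governed by the level `hB`, and whose value governs `hA`. -/
structure StateCoord.IsGraded {X K : Type} (s : StateCoord X K) (k₀ : K) (n : ℕ)
    (hA hB : X → ℕ) : Prop where
  level_upd_other : ∀ x i, hB (s.upd x i) = hB x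
  level_upd_le : ∀ x i, hA (s.upd x i) ≤ max (hA x) (hB x + 1)
  label_eq : ∀ x, hB x < n → hA x ≤ hB x → s.label x = k₀
  lt_level_upd : ∀ x i, hB x < n → i ≠ k₀ → hB x < hA (s.upd x i)

section FockCoord

variable {K L : Type} [DecidableEq K] [DecidableEq L]

/-- The position at which a letter is written, determined by the word of the other type. -/
def writePos (n : ℕ) (l₀ : L) (g : Fin (n + 1) → L) : Fin (n + 1) :=
  ⟨wordLevel n l₀ g, wordLevel_lt_succ n l₀ g⟩

/-- The active coordinate of the first word, at the position given by the second word. -/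
def fstCoord (n : ℕ) (l₀ : L) : StateCoord ((Fin (n + 1) → K) × (Fin (n + 1) → L)) K where
  label x := x.1 (writePos n l₀ x.2)
  upd x i := (Function.update x.1 (writePos n l₀ x.2) i, x.2)
  label_upd := by simp
  upd_upd := by simp
  upd_label := by simp

/-- The active coordinate of the second word, at the position given by the first word. -/
def sndCoord (n : ℕ) (k₀ : K) : StateCoord ((Fin (n + 1) → K) × (Fin (n + 1) → L)) L where
  label x := x.2 (writePos n k₀ x.1)
  upd x i := (x.1, Function.update x.2 (writePos n k₀ x.1) i)
  label_upd := by simp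
  upd_upd := by simp
  upd_label := by simp

theorem fstCoord_isGraded (n : ℕ) (k₀ : K) (l₀ : L) :
    (fstCoord (K := K) n l₀).IsGraded k₀ n (fun x => wordLevel n k₀ x.1)
      (fun x => wordLevel n l₀ x.2) where
  level_upd_other _ _ := rfl
  level_upd_le _ _ := wordLevel_update_le ..
  label_eq _ h h' := eq_of_wordLevel_le (j := writePos n l₀ _) h h'
  lt_level_upd x _ h h' := lt_wordLevel_update x.1 (j := writePos n l₀ _) h h'

theorem sndCoord_isGraded (n : ℕ) (k₀ : K) (l₀ : L) :
    (sndCoord (L := L) n k₀).IsGraded l₀ n (fun x => wordLevel n l₀ x.2)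
      (fun x => wordLevel n k₀ x.1) where
  level_upd_other _ _ := rfl
  level_upd_le _ _ := wordLevel_update_le ..
  label_eq _ h h' := eq_of_wordLevel_le (j := writePos n k₀ _) h h'
  lt_level_upd x _ h h' := lt_wordLevel_update x.2 (j := writePos n k₀ _) h h'

end FockCoord

/-! ### Alternating products of subspaces -/

section AltProd

variable {C : Type} [Ring C] [Algebra ℂ C]

/-- The span of the alternating products `m₁ * n₁ * m₂ * ⋯` with `k` factors. -/
def altProd (M N : Submodule ℂ C) : ℕ → Submodule ℂ C
  | 0 => 1
  | k + 1 => M * altProd N M k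
termination_by k => k

theorem altProd_zero (M N : Submodule ℂ C) : altProd M N 0 = 1 := by rw [altProd]

theorem altProd_succ (M N : Submodule ℂ C) (k : ℕ) :
    altProd M N (k + 1) = M * altProd N M k := by rw [altProd]

theorem altProd_mono {M M' N N' : Submodule ℂ C} (hM : M ≤ M') (hN : N ≤ N') (k : ℕ) :
    altProd M N k ≤ altProd M' N' k := by
  induction k generalizing M M' N N' with
  | zero => simp [altProd_zero]
  | succ k ih =>
    rw [altProd_succ, altProd_succ]
    exact mul_le_mul' hM (ih hN hM)

theorem altProd_le_pow {M N U : Submodule ℂ C} (hM : M ≤ U) (hN : N ≤ U) (k : ℕ) :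
    altProd M N k ≤ U ^ k := by
  induction k generalizing M N with
  | zero => simp [altProd_zero]
  | succ k ih =>
    rw [altProd_succ, pow_succ']
    exact mul_le_mul' hM (ih hN hM)

theorem altProd_le_succ {M N : Submodule ℂ C} (hM : 1 ∈ M) (hN : 1 ∈ N) (k : ℕ) :
    altProd M N k ≤ altProd M N (k + 1) := by
  induction k generalizing M N with
  | zero => simpa [altProd_succ, altProd_zero] using hM
  | succ k ih =>
    rw [altProd_succ M N k, altProd_succ M N (k + 1)]
    exact mul_le_mul' le_rfl (ih hN hM)

theorem sup_pow_le_altProd {M N : Submodule ℂ C} (hM : 1 ∈ M) (hN : 1 ∈ N) (hMM : M * M ≤ M)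
    (hNN : N * N ≤ N) (k : ℕ) : (M ⊔ N) ^ k ≤ altProd M N k ⊔ altProd N M k := by
  have absorb : ∀ {M N : Submodule ℂ C}, 1 ∈ M → 1 ∈ N → M * M ≤ M →
      ∀ k, M * altProd M N k ≤ altProd M N (k + 1) := by
    intro M N hM hN hMM k
    cases k with
    | zero => rw [altProd_succ, altProd_zero, altProd_zero]
    | succ k =>
      rw [altProd_succ M N k, ← mul_assoc, altProd_succ M N (k + 1)]
      exact mul_le_mul' hMM (altProd_le_succ hN hM k)
  induction k with
  | zero => simp [altProd_zero]
  | succ k ih =>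
    rw [pow_succ']
    refine (mul_le_mul' le_rfl ih).trans ?_
    rw [Submodule.sup_mul, Submodule.mul_sup, Submodule.mul_sup, ← altProd_succ, ← altProd_succ]
    refine sup_le (sup_le ?_ le_sup_left) (sup_le le_sup_right ?_)
    · exact (absorb hM hN hMM k).trans le_sup_left
    · exact (absorb hN hM hNN k).trans le_sup_right

theorem exists_fg_mem_altProd {A B : Type} [AddCommGroup A] [Module ℂ A] [AddCommGroup B]
    [Module ℂ B] (f : A →ₗ[ℂ] C) (g : B →ₗ[ℂ] C) (k : ℕ) {c : C}
    (hc : c ∈ altProd (LinearMap.range f) (LinearMap.range g) k) :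
    ∃ (V : Submodule ℂ A) (W : Submodule ℂ B), V.FG ∧ W.FG ∧ c ∈ altProd (V.map f) (W.map g) k := by
  induction k generalizing A B c with
  | zero =>
    exact ⟨⊥, ⊥, Submodule.fg_bot, Submodule.fg_bot, by simpa [altProd_zero] using hc⟩
  | succ k ih =>
    rw [altProd_succ] at hc
    induction hc using Submodule.mul_induction_on' with
    | mem_mul_mem m hm q hq =>
      obtain ⟨a, rfl⟩ := hm
      obtain ⟨W, V, hW, hV, hmem⟩ := ih g f hq
      refine ⟨V ⊔ Submodule.span ℂ {a}, W, hV.sup (Submodule.fg_span_singleton a), hW, ?_⟩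
      rw [altProd_succ]
      refine Submodule.mul_mem_mul (Submodule.mem_map_of_mem ?_)
        (altProd_mono le_rfl (Submodule.map_mono le_sup_left) k hmem)
      exact Submodule.mem_sup_right (Submodule.mem_span_singleton_self a)
    | add x _ y _ hx hy =>
      obtain ⟨V, W, hV, hW, h⟩ := hx
      obtain ⟨V', W', hV', hW', h'⟩ := hy
      exact ⟨V ⊔ V', W ⊔ W', hV.sup hV', hW.sup hW', add_mem
        (altProd_mono (Submodule.map_mono le_sup_left) (Submodule.map_mono le_sup_left) _ h)
        (altProd_mono (Submodule.map_mono le_sup_right) (Submodule.map_mono le_sup_right) _ h')⟩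

end AltProd

/-! ### The vacuum vector -/

section Vacuum

variable {C : Type} [Ring C] [Algebra ℂ C] {X : Type} [Fintype X] [DecidableEq X]

/-- The image of the basis vector at `ω` under the operator `ρ c`. -/
def vacuumOrbit (ρ : C →ₐ[ℂ] Matrix X X ℂ) (ω : X) : C →ₗ[ℂ] X → ℂ where
  toFun c := (ρ c).mulVec (Pi.single ω 1)
  map_add' a b := by rw [map_add, Matrix.add_mulVec]
  map_smul' r a := by rw [map_smul, Matrix.smul_mulVec, RingHom.id_apply]

variable (ρ : C →ₐ[ℂ] Matrix X X ℂ) (ω : X)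

theorem vacuumOrbit_mul (a c : C) :
    vacuumOrbit ρ ω (a * c) = (ρ a).mulVec (vacuumOrbit ρ ω c) := by
  simp only [vacuumOrbit, LinearMap.coe_mk, AddHom.coe_mk, map_mul, Matrix.mulVec_mulVec]

theorem vacuumOrbit_one : vacuumOrbit ρ ω 1 = Pi.single ω 1 := by
  simp only [vacuumOrbit, LinearMap.coe_mk, AddHom.coe_mk, map_one, Matrix.one_mulVec]

variable {K L : Type} [Fintype K] [Fintype L]
  {s : StateCoord X K} {t : StateCoord X L} {k₀ : K} {l₀ : L} {n : ℕ} {hA hB : X → ℕ}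
  {M N U : Submodule ℂ C}

theorem vacuumOrbit_mul_apply {c : C} {m : Matrix K K ℂ} (hc : ρ c = s.ampl m) (q : C) (x : X) :
    vacuumOrbit ρ ω (c * q) x = ∑ i, m (s.label x) i * vacuumOrbit ρ ω q (s.upd x i) := by
  rw [vacuumOrbit_mul, hc, s.ampl_mulVec]

/-- The orbit vectors of elements of `P` are supported on states whose levels `hA` and `hB` are at
most `k` and `k - 1`. -/
def OrbitSupported (hA hB : X → ℕ) (P : Submodule ℂ C) (k : ℕ) : Prop :=
  ∀ p ∈ P, ∀ x, vacuumOrbit ρ ω p x ≠ 0 → hA x ≤ k ∧ hB x ≤ k - 1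

theorem OrbitSupported.succ (hs : s.IsGraded k₀ n hA hB) (hM : ∀ c ∈ M, ∃ m, ρ c = s.ampl m)
    {k : ℕ} (ih : OrbitSupported ρ ω hB hA (altProd N M k) k) :
    OrbitSupported ρ ω hA hB (altProd M N (k + 1)) (k + 1) := by
  intro p hp
  rw [altProd_succ] at hp
  induction hp using Submodule.mul_induction_on' with
  | mem_mul_mem c hc q hq =>
    intro x hx
    obtain ⟨m, hm⟩ := hM c hc
    rw [vacuumOrbit_mul_apply ρ ω hm] at hx
    obtain ⟨i, -, hi⟩ := Finset.exists_ne_zero_of_sum_ne_zero hx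
    obtain ⟨h1, h2⟩ := ih q hq _ (right_ne_zero_of_mul hi)
    have h3 := hs.level_upd_le (s.upd x i) (s.label x)
    rw [s.upd_upd, s.upd_label] at h3
    rw [hs.level_upd_other] at h1 h3
    omega
  | add y _ z _ hy hz =>
    intro x hx
    rw [map_add, Pi.add_apply] at hx
    by_cases h : vacuumOrbit ρ ω y x = 0
    · exact hz x (by simpa [h] using hx)
    · exact hy x h

theorem orbitSupported_altProd (hs : s.IsGraded k₀ n hA hB) (ht : t.IsGraded l₀ n hB hA)
    (hM : ∀ c ∈ M, ∃ m, ρ c = s.ampl m) (hN : ∀ c ∈ N, ∃ m, ρ c = t.ampl m)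
    (hAω : hA ω = 0) (hBω : hB ω = 0) (k : ℕ) :
    OrbitSupported ρ ω hA hB (altProd M N k) k ∧ OrbitSupported ρ ω hB hA (altProd N M k) k := by
  induction k with
  | zero =>
    have key : ∀ p ∈ (1 : Submodule ℂ C), ∀ x, vacuumOrbit ρ ω p x ≠ 0 → x = ω := by
      intro p hp x hx
      obtain ⟨r, rfl⟩ := Submodule.mem_one.1 hp
      by_contra h
      rw [Algebra.algebraMap_eq_smul_one, map_smul, vacuumOrbit_one] at hx
      simp [h] at hx
    simp only [OrbitSupported, altProd_zero]
    refine ⟨fun p hp x hx => ?_, fun p hp x hx => ?_⟩ <;>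
      · obtain rfl := key p hp x hx
        simp [hAω, hBω]
  | succ k ih => exact ⟨.succ ρ ω hs hM ih.2, .succ ρ ω ht hN ih.1⟩

/-- Elements of `P` whose orbit vector vanishes on all states of top level `k` lie in `Q`. -/
def TopDetected (hA hB : X → ℕ) (P Q : Submodule ℂ C) (k : ℕ) : Prop :=
  ∀ p ∈ P, (∀ x, hA x = k → hB x ≤ k - 1 → vacuumOrbit ρ ω p x = 0) → p ∈ Q

/-- Every element of `M` acts through the coordinate `s`, and is recovered linearly from the column
at `k₀` of its matrix, by vectors in `U` of which the one at `k₀` is the unit. -/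
def ColumnRecovers (s : StateCoord X K) (k₀ : K) (M U : Submodule ℂ C) : Prop :=
  ∃ v : K → C, v k₀ = 1 ∧ (∀ k, v k ∈ U) ∧
    ∀ c ∈ M, ∃ m, ρ c = s.ampl m ∧ c = ∑ k, m k k₀ • v k

/-- The powers of `U` shifted by one, starting with the zero subspace. -/
def shiftedPow (U : Submodule ℂ C) : ℕ → Submodule ℂ C
  | 0 => ⊥
  | k + 1 => U ^ k

theorem mul_shiftedPow_le (k : ℕ) : U * shiftedPow U k ≤ shiftedPow U (k + 1) := by
  cases k with
  | zero => simp [shiftedPow]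
  | succ k => exact (pow_succ' U k).ge

theorem TopDetected.succ [DecidableEq K] (hs : s.IsGraded k₀ n hA hB)
    (hM : ColumnRecovers ρ s k₀ M U) (hMU : M ≤ U) (hNU : N ≤ U)
    {k : ℕ} (hk : k < n) (hsupp : OrbitSupported ρ ω hB hA (altProd N M k) k)
    (ih : TopDetected ρ ω hB hA (altProd N M k) (shiftedPow U k) k) :
    TopDetected ρ ω hA hB (altProd M N (k + 1)) (shiftedPow U (k + 1)) (k + 1) := by
  obtain ⟨v, hv₀, hvU, hv⟩ := hM
  intro p hp htop
  have decomp : ∃ q : K → C, (∀ i, q i ∈ altProd N M k) ∧ p = ∑ i, v i * q i ∧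
      ∀ x, hB x = k → hA x ≤ k - 1 → ∀ i,
        vacuumOrbit ρ ω p (s.upd x i) = vacuumOrbit ρ ω (q i) x := by
    clear htop
    rw [altProd_succ] at hp
    induction hp using Submodule.mul_induction_on' with
    | mem_mul_mem c hc q hq =>
      obtain ⟨m, hm, hcm⟩ := hv c hc
      refine ⟨fun i => m i k₀ • q, fun i => Submodule.smul_mem _ _ hq, ?_, ?_⟩
      · conv_lhs => rw [hcm]
        simp [Finset.sum_mul]
      · intro x hx hx' i
        rw [vacuumOrbit_mul_apply ρ ω hm, s.label_upd, Finset.sum_eq_single k₀]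
        · rw [s.upd_upd, ← hs.label_eq x (by omega) (by omega), s.upd_label]
          simp
        · intro j _ hj
          rw [s.upd_upd]
          have h1 := hs.lt_level_upd x j (by omega) hj
          by_contra h2
          have h3 := (hsupp q hq _ (right_ne_zero_of_mul h2)).2
          omega
        · simp
    | add y _ z _ hy hz =>
      obtain ⟨q, hq, rfl, hqt⟩ := hy
      obtain ⟨r, hr, rfl, hrt⟩ := hz
      refine ⟨q + r, fun i => add_mem (hq i) (hr i), ?_, ?_⟩
      · simp [mul_add, Finset.sum_add_distrib]
      · intro x hx hx' i
        rw [map_add, Pi.add_apply, hqt x hx hx', hrt x hx hx', Pi.add_apply, map_add, Pi.add_apply]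
  obtain ⟨q, hq, rfl, hqt⟩ := decomp
  refine sum_mem fun i _ => ?_
  by_cases hi : i = k₀
  · subst hi
    rw [hv₀, one_mul]
    exact altProd_le_pow hNU hMU k (hq i)
  · refine mul_shiftedPow_le k (Submodule.mul_mem_mul (hvU i) (ih _ (hq i) fun x hx hx' => ?_))
    rw [← hqt x hx hx' i]
    refine htop _ ?_ ?_
    · have h1 := hs.lt_level_upd x i (by omega) hi
      have h2 := hs.level_upd_le x i
      omega
    · rw [hs.level_upd_other]
      omega

theorem topDetected_altProd [DecidableEq K] [DecidableEq L] (hs : s.IsGraded k₀ n hA hB)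
    (ht : t.IsGraded l₀ n hB hA) (hM : ColumnRecovers ρ s k₀ M U) (hN : ColumnRecovers ρ t l₀ N U)
    (hMU : M ≤ U) (hNU : N ≤ U) (hAω : hA ω = 0) (hBω : hB ω = 0) {k : ℕ} (hk : k ≤ n) :
    TopDetected ρ ω hA hB (altProd M N k) (shiftedPow U k) k ∧
      TopDetected ρ ω hB hA (altProd N M k) (shiftedPow U k) k := by
  induction k with
  | zero =>
    have key : ∀ p ∈ (1 : Submodule ℂ C), vacuumOrbit ρ ω p ω = 0 → p = 0 := by
      intro p hp h
      obtain ⟨r, rfl⟩ := Submodule.mem_one.1 hp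
      rw [Algebra.algebraMap_eq_smul_one, map_smul, vacuumOrbit_one] at h
      simp_all
    simp only [TopDetected, altProd_zero, shiftedPow, Submodule.mem_bot]
    exact ⟨fun p hp h => key p hp (h ω hAω (by omega)),
      fun p hp h => key p hp (h ω hBω (by omega))⟩
  | succ k ih =>
    have hM' : ∀ c ∈ M, ∃ m, ρ c = s.ampl m := fun c hc =>
      (hM.choose_spec.2.2 c hc).imp fun _ h => h.1
    have hN' : ∀ c ∈ N, ∃ m, ρ c = t.ampl m := fun c hc =>
      (hN.choose_spec.2.2 c hc).imp fun _ h => h.1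
    have hsupp := orbitSupported_altProd ρ ω hs ht hM' hN' hAω hBω k
    have ih := ih (by omega)
    exact ⟨.succ ρ ω hs hM hMU hNU (by omega) hsupp.2 ih.2,
      .succ ρ ω ht hN hNU hMU (by omega) hsupp.1 ih.1⟩

end Vacuum

/-! ### Separating vectors -/

section Separating

/-- Block-diagonal sum of two *-representations by matrices. -/
def StarAlgHom.matrixSum {A m n : Type} [Ring A] [Algebra ℂ A] [StarRing A] [StarModule ℂ A]
    [Fintype m] [DecidableEq m] [Fintype n] [DecidableEq n]
    (π : A →⋆ₐ[ℂ] Matrix m m ℂ) (σ : A →⋆ₐ[ℂ] Matrix n n ℂ) :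
    A →⋆ₐ[ℂ] Matrix (m ⊕ n) (m ⊕ n) ℂ where
  toFun a := Matrix.fromBlocks (π a) 0 0 (σ a)
  map_one' := by simp
  map_mul' a b := by simp [Matrix.fromBlocks_multiply]
  map_zero' := by simp
  map_add' a b := by simp [Matrix.fromBlocks_add]
  commutes' r := by
    rw [AlgHomClass.commutes, AlgHomClass.commutes]
    simp only [Algebra.algebraMap_eq_smul_one]
    rw [← Matrix.fromBlocks_one, Matrix.fromBlocks_smul, smul_zero, smul_zero]
  map_star' a := by
    simp only [map_star, Matrix.star_eq_conjTranspose, Matrix.fromBlocks_conjTranspose,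
      Matrix.conjTranspose_zero]

variable {A : Type} [Ring A] [Algebra ℂ A] [StarRing A] [StarModule ℂ A]

/-- A finite-dimensional subspace of an RFD algebra has a separating vector in some
finite-dimensional *-representation. -/
theorem IsRFD.exists_separating_vector (hA : IsRFD A) (V : Submodule ℂ A) (hV : V.FG) :
    ∃ (m : Type) (_ : Fintype m) (_ : DecidableEq m) (π : A →⋆ₐ[ℂ] Matrix m m ℂ) (ξ : m → ℂ),
      ∀ a ∈ V, (π a).mulVec ξ = 0 → a = 0 := by
  have : FiniteDimensional ℂ V := Module.Finite.iff_fg.2 hV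
  suffices H : ∀ (d : ℕ) (W : Submodule ℂ A), W ≤ V → Module.finrank ℂ W = d →
      ∀ (m : Type) (_ : Fintype m) (_ : DecidableEq m) (π : A →⋆ₐ[ℂ] Matrix m m ℂ) (ξ : m → ℂ),
      (∀ a ∈ V, (π a).mulVec ξ = 0 → a ∈ W) →
      ∃ (m : Type) (_ : Fintype m) (_ : DecidableEq m) (π : A →⋆ₐ[ℂ] Matrix m m ℂ) (ξ : m → ℂ),
        ∀ a ∈ V, (π a).mulVec ξ = 0 → a = 0 by
    let π : A →⋆ₐ[ℂ] Matrix Empty Empty ℂ :=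
      { toFun := 0
        map_one' := Subsingleton.elim _ _
        map_mul' := fun _ _ => Subsingleton.elim _ _
        map_zero' := Subsingleton.elim _ _
        map_add' := fun _ _ => Subsingleton.elim _ _
        commutes' := fun _ => Subsingleton.elim _ _
        map_star' := fun _ => Subsingleton.elim _ _ }
    exact H _ V le_rfl rfl Empty inferInstance inferInstance π 0 fun a ha _ => ha
  intro d
  induction d using Nat.strong_induction_on with
  | _ d ih =>
    intro W hWV hd m _ _ π ξ hW
    by_cases hbot : W = ⊥
    · exact ⟨m, _, _, π, ξ, fun a ha h => by simpa [hbot] using hW a ha h⟩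
    obtain ⟨b, hb, hb0⟩ := W.ne_bot_iff.1 hbot
    obtain ⟨n, σ, hσ⟩ := hA b hb0
    obtain ⟨j, hj⟩ : ∃ j, (σ b).mulVec (Pi.single j 1) ≠ 0 := by
      by_contra! h
      exact hσ (Matrix.ext_of_mulVec_single fun j => by rw [h j, Matrix.zero_mulVec])
    let T : A →ₗ[ℂ] Fin n → ℂ :=
      { toFun := fun a => (σ a).mulVec (Pi.single j 1)
        map_add' := fun x y => by rw [map_add, Matrix.add_mulVec]
        map_smul' := fun r x => by rw [map_smul, Matrix.smul_mulVec, RingHom.id_apply] }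
    have : FiniteDimensional ℂ W := Submodule.finiteDimensional_of_le hWV
    have hlt : W ⊓ LinearMap.ker T < W := by
      refine lt_of_le_of_ne inf_le_left fun h => hj ?_
      have : b ∈ W ⊓ LinearMap.ker T := by rw [h]; exact hb
      exact this.2
    refine ih _ (hd ▸ Submodule.finrank_lt_finrank_of_lt hlt) _ (inf_le_left.trans hWV) rfl
      (m ⊕ Fin n) inferInstance inferInstance (π.matrixSum σ) (Sum.elim ξ (Pi.single j 1)) ?_
    intro a ha h
    have h' : Sum.elim ((π a).mulVec ξ) ((σ a).mulVec (Pi.single j 1)) = 0 := by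
      rw [← h]
      change _ = (Matrix.fromBlocks (π a) 0 0 (σ a)).mulVec _
      rw [Matrix.fromBlocks_mulVec, Sum.elim_comp_inl, Sum.elim_comp_inr, Matrix.zero_mulVec,
        Matrix.zero_mulVec, add_zero, zero_add]
    exact ⟨hW a ha (funext fun i => congrFun h' (Sum.inl i)),
      funext fun i => congrFun h' (Sum.inr i)⟩

/-- After a unitary change of basis, the separating vector may be taken to be a basis vector. -/
theorem IsRFD.exists_separating_column (hA : IsRFD A) [Nontrivial A] (V : Submodule ℂ A)
    (hV : V.FG) (h1 : 1 ∈ V) :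
    ∃ (m : Type) (_ : Fintype m) (_ : DecidableEq m) (π : A →⋆ₐ[ℂ] Matrix m m ℂ) (k₀ : m),
      ∀ a ∈ V, (∀ k, π a k k₀ = 0) → a = 0 := by
  obtain ⟨m, _, _, π, ξ, hξ⟩ := hA.exists_separating_vector V hV
  have hξ0 : ξ ≠ 0 := by
    rintro rfl
    exact one_ne_zero (hξ 1 h1 (Matrix.mulVec_zero _))
  let x : EuclideanSpace ℂ m := WithLp.toLp 2 ξ
  have hx : x ≠ 0 := fun h => hξ0 (congrArg WithLp.ofLp h)
  obtain ⟨k₀, -⟩ := Function.ne_iff.1 hξ0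
  let e : m → EuclideanSpace ℂ m := fun _ => ((‖x‖⁻¹ : ℝ) : ℂ) • x
  have hnorm : ‖((‖x‖⁻¹ : ℝ) : ℂ) • x‖ = 1 := by
    rw [norm_smul, Complex.norm_real, norm_inv, norm_norm, inv_mul_cancel₀ (norm_ne_zero_iff.2 hx)]
  have he : Orthonormal ℂ (({k₀} : Set m).domRestrict e) :=
    ⟨fun _ => hnorm, fun i j hij => (hij (Subsingleton.elim i j)).elim⟩
  obtain ⟨b, hb⟩ := he.exists_orthonormalBasis_extension_of_card_eq (by simp)
  let Φ := (LinearMap.toMatrixOrthonormal (EuclideanSpace.basisFun m ℂ)).symm.trans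
    (LinearMap.toMatrixOrthonormal b)
  refine ⟨m, _, _, (Φ : Matrix m m ℂ →⋆ₐ[ℂ] Matrix m m ℂ).comp π, k₀, fun a ha h => hξ a ha ?_⟩
  let f := (LinearMap.toMatrixOrthonormal (EuclideanSpace.basisFun m ℂ)).symm (π a)
  have hf : f (b k₀) = 0 := by
    refine b.repr.map_eq_zero_iff.1 ?_
    ext k
    rw [b.repr_apply_apply, ← LinearMap.toMatrixOrthonormal_apply_apply]
    exact h k
  rw [hb k₀ rfl, map_smul, smul_eq_zero] at hf
  have hfx : f x = 0 := hf.resolve_left (by simpa using hx)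
  have hfe : f x = WithLp.toLp 2 ((π a).mulVec ξ) := rfl
  exact congrArg WithLp.ofLp (hfe.symm.trans hfx)

end Separating

/-! ### Coproducts -/

section StarAlgHom

variable {A C : Type} [Ring A] [Algebra ℂ A] [StarRing A] [Ring C] [Algebra ℂ C] [StarRing C]

/-- The range of a *-homomorphism, as a subspace. -/
def StarAlgHom.rangeSubmodule (f : A →⋆ₐ[ℂ] C) : Submodule ℂ C :=
  LinearMap.range f.toAlgHom.toLinearMap

theorem StarAlgHom.apply_mem_rangeSubmodule (f : A →⋆ₐ[ℂ] C) (a : A) : f a ∈ f.rangeSubmodule :=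
  ⟨a, rfl⟩

theorem StarAlgHom.one_mem_rangeSubmodule (f : A →⋆ₐ[ℂ] C) : 1 ∈ f.rangeSubmodule :=
  ⟨1, map_one f⟩

theorem StarAlgHom.rangeSubmodule_mul_self_le (f : A →⋆ₐ[ℂ] C) :
    f.rangeSubmodule * f.rangeSubmodule ≤ f.rangeSubmodule := by
  rw [Submodule.mul_le]
  rintro _ ⟨a, rfl⟩ _ ⟨b, rfl⟩
  exact ⟨a * b, map_mul f a b⟩

/-- Relabelling of a *-representation by matrices over a finite index type. -/
noncomputable def StarAlgHom.reindexFin {X : Type} [Fintype X] [DecidableEq X] (ρ : C →⋆ₐ[ℂ] Matrix X X ℂ) :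
    C →⋆ₐ[ℂ] Matrix (Fin (Fintype.card X)) (Fin (Fintype.card X)) ℂ :=
  { (Matrix.reindexAlgEquiv ℂ ℂ (Fintype.equivFin X)).toAlgHom.comp ρ.toAlgHom with
    map_star' := fun c => by
      change Matrix.reindexAlgEquiv ℂ ℂ _ (ρ (star c)) = star (Matrix.reindexAlgEquiv ℂ ℂ _ (ρ c))
      rw [map_star]
      rfl }

theorem StarAlgHom.reindexFin_ne_zero {X : Type} [Fintype X] [DecidableEq X]
    {ρ : C →⋆ₐ[ℂ] Matrix X X ℂ} {c : C} (h : ρ c ≠ 0) : ρ.reindexFin c ≠ 0 :=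
  (map_ne_zero_iff _ (Matrix.reindexAlgEquiv ℂ ℂ (Fintype.equivFin X)).injective).2 h

theorem columnRecovers_map {X K : Type} [Fintype X] [DecidableEq X] [Fintype K] [DecidableEq K]
    {ia : A →⋆ₐ[ℂ] C} {ρ : C →ₐ[ℂ] Matrix X X ℂ} {s : StateCoord X K} {k₀ : K} {π : A →⋆ₐ[ℂ] Matrix K K ℂ}
    (hρ : ∀ a, ρ (ia a) = s.ampl (π a)) {V : Submodule ℂ A} (h1 : 1 ∈ V)
    (hV : ∀ a ∈ V, (∀ k, π a k k₀ = 0) → a = 0) {U : Submodule ℂ C} (hU : ia.rangeSubmodule ≤ U) :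
    ColumnRecovers ρ s k₀ (V.map ia.toAlgHom.toLinearMap) U := by
  let T : V →ₗ[ℂ] K → ℂ :=
    { toFun := fun a k => π a k k₀
      map_add' := fun x y => by ext k; simp
      map_smul' := fun r x => by ext k; simp }
  obtain ⟨S, hS⟩ := T.exists_leftInverse_of_injective <| (LinearMap.ker_eq_bot').2 fun a ha =>
    Subtype.ext (hV a a.2 fun k => congrFun ha k)
  have hST : ∀ a, S (T a) = a := fun a => DFunLike.congr_fun hS a
  refine ⟨fun k => ia (S (Pi.single k 1) : V), ?_,
    fun k => hU (ia.apply_mem_rangeSubmodule _), ?_⟩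
  · have hT : T ⟨1, h1⟩ = Pi.single k₀ 1 := by
      ext k
      simp [T, Matrix.one_apply, Pi.single_apply]
    change ia (S (Pi.single k₀ 1) : V) = 1
    rw [← hT, hST, map_one]
  · rintro _ ⟨a, ha, rfl⟩
    refine ⟨π a, hρ a, ?_⟩
    have hTa : T ⟨a, ha⟩ = ∑ k, π a k k₀ • Pi.single k 1 := pi_eq_sum_univ' _
    have h2 := congrArg (fun b : V => ia b) (hST ⟨a, ha⟩)
    rw [hTa] at h2
    simpa using h2.symm

end StarAlgHom

section Coproduct

variable {A B C : Type}
  [Ring A] [Algebra ℂ A] [StarRing A] [StarModule ℂ A]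
  [Ring B] [Algebra ℂ B] [StarRing B] [StarModule ℂ B]
  [Ring C] [Algebra ℂ C] [StarRing C] [StarModule ℂ C]
  {ia : A →⋆ₐ[ℂ] C} {ib : B →⋆ₐ[ℂ] C}

theorem IsStarAlgCoproduct.symm (hC : IsStarAlgCoproduct ia ib) : IsStarAlgCoproduct ib ia := by
  intro D _ _ _ _ f g
  simpa only [and_comm] using hC D g f

theorem IsStarAlgCoproduct.eq_top (hC : IsStarAlgCoproduct ia ib) (S : StarSubalgebra ℂ C)
    (hSA : ∀ a, ia a ∈ S) (hSB : ∀ b, ib b ∈ S) : S = ⊤ := by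
  obtain ⟨h, ⟨h1, h2⟩, -⟩ := hC S (ia.codRestrict S hSA) (ib.codRestrict S hSB)
  obtain ⟨r, -, hr⟩ := hC C ia ib
  have key : S.subtype.comp h = StarAlgHom.id ℂ C := by
    rw [hr (StarAlgHom.id ℂ C) ⟨rfl, rfl⟩]
    refine hr _ ⟨?_, ?_⟩
    · rw [StarAlgHom.comp_assoc, h1]
      rfl
    · rw [StarAlgHom.comp_assoc, h2]
      rfl
  refine eq_top_iff.2 fun c _ => ?_
  have := DFunLike.congr_fun key c
  rw [← show S.subtype (h c) = c from this]
  exact (h c).2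

theorem star_mem_pow {U : Submodule ℂ C} (hU : ∀ c ∈ U, star c ∈ U) (n : ℕ) {c : C}
    (hc : c ∈ U ^ n) : star c ∈ U ^ n := by
  induction n generalizing c with
  | zero =>
    rw [pow_zero] at hc ⊢
    obtain ⟨r, rfl⟩ := Submodule.mem_one.1 hc
    rw [← algebraMap_star_comm]
    exact Submodule.algebraMap_mem _
  | succ n ih =>
    rw [pow_succ] at hc
    induction hc using Submodule.mul_induction_on' with
    | mem_mul_mem x hx y hy =>
      rw [star_mul, pow_succ']
      exact Submodule.mul_mem_mul (hU y hy) (ih hx)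
    | add x _ y _ hx hy =>
      rw [star_add]
      exact add_mem hx hy

theorem IsStarAlgCoproduct.exists_mem_pow (hC : IsStarAlgCoproduct ia ib) (c : C) :
    ∃ n, c ∈ (ia.rangeSubmodule ⊔ ib.rangeSubmodule) ^ n := by
  set U := ia.rangeSubmodule ⊔ ib.rangeSubmodule with hUdef
  have hA : ∀ a, ia a ∈ U := fun a => Submodule.mem_sup_left (ia.apply_mem_rangeSubmodule a)
  have hB : ∀ b, ib b ∈ U := fun b => Submodule.mem_sup_right (ib.apply_mem_rangeSubmodule b)
  have hU1 : (1 : Submodule ℂ C) ≤ U := by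
    simpa [hUdef] using Submodule.mem_sup_left (T := ib.rangeSubmodule) ia.one_mem_rangeSubmodule
  have hUstar : ∀ c ∈ U, star c ∈ U := by
    intro c hc
    obtain ⟨_, ⟨a, rfl⟩, _, ⟨b, rfl⟩, rfl⟩ := Submodule.mem_sup.1 hc
    rw [star_add]
    refine add_mem ?_ ?_
    · exact (map_star ia a) ▸ hA (star a)
    · exact (map_star ib b) ▸ hB (star b)
  let S : StarSubalgebra ℂ C :=
    { carrier := {c | ∃ n, c ∈ U ^ n}
      mul_mem' := by
        rintro a b ⟨m, hm⟩ ⟨n, hn⟩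
        exact ⟨m + n, by rw [pow_add]; exact Submodule.mul_mem_mul hm hn⟩
      add_mem' := by
        rintro a b ⟨m, hm⟩ ⟨n, hn⟩
        exact ⟨max m n, add_mem (pow_le_pow_right' hU1 (le_max_left m n) hm)
          (pow_le_pow_right' hU1 (le_max_right m n) hn)⟩
      algebraMap_mem' := fun r => ⟨0, by rw [pow_zero]; exact Submodule.algebraMap_mem r⟩
      star_mem' := fun ⟨n, hn⟩ => ⟨n, star_mem_pow hUstar n hn⟩ }
  have hS : S = ⊤ := hC.eq_top S (fun a => ⟨1, by simpa using hA a⟩)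
    fun b => ⟨1, by simpa using hB b⟩
  exact (hS ▸ StarSubalgebra.mem_top : c ∈ S)

theorem IsStarAlgCoproduct.exists_hom_ne_zero [Nontrivial A] [Nontrivial B]
    (hC : IsStarAlgCoproduct ia ib) (hA : IsRFD A) (hB : IsRFD B) {n : ℕ} {p q : C}
    (hp : p ∈ altProd ia.rangeSubmodule ib.rangeSubmodule n)
    (hq : q ∈ altProd ib.rangeSubmodule ia.rangeSubmodule n) (hn : n = 0 → q = 0)
    (hpU : p ∉ shiftedPow (ia.rangeSubmodule ⊔ ib.rangeSubmodule) n) :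
    ∃ (X : Type) (_ : Fintype X) (_ : DecidableEq X) (ρ : C →⋆ₐ[ℂ] Matrix X X ℂ),
      ρ (p + q) ≠ 0 := by
  obtain ⟨V', W', hV', hW', hpVW'⟩ := exists_fg_mem_altProd _ _ n hp
  obtain ⟨V, hV, hVV, h1V⟩ : ∃ V : Submodule ℂ A, V.FG ∧ V' ≤ V ∧ 1 ∈ V :=
    ⟨V' ⊔ Submodule.span ℂ {1}, hV'.sup (Submodule.fg_span_singleton 1), le_sup_left,
      Submodule.mem_sup_right (Submodule.mem_span_singleton_self 1)⟩
  obtain ⟨W, hW, hWW, h1W⟩ : ∃ W : Submodule ℂ B, W.FG ∧ W' ≤ W ∧ 1 ∈ W :=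
    ⟨W' ⊔ Submodule.span ℂ {1}, hW'.sup (Submodule.fg_span_singleton 1), le_sup_left,
      Submodule.mem_sup_right (Submodule.mem_span_singleton_self 1)⟩
  have hpVW := altProd_mono (Submodule.map_mono hVV) (Submodule.map_mono hWW) n hpVW'
  obtain ⟨K, _, _, π, k₀, hπ⟩ := hA.exists_separating_column V hV h1V
  obtain ⟨L, _, _, σ, l₀, hσ⟩ := hB.exists_separating_column W hW h1W
  obtain ⟨ρ, ⟨hρA, hρB⟩, -⟩ := hC _ ((fstCoord (K := K) n l₀).amplHom.comp π)
    ((sndCoord (L := L) n k₀).amplHom.comp σ)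
  refine ⟨_, _, _, ρ, fun h0 => hpU ?_⟩
  have hA' : ∀ a, ρ.toAlgHom (ia a) = (fstCoord (K := K) n l₀).ampl (π a) :=
    fun a => DFunLike.congr_fun hρA a
  have hB' : ∀ b, ρ.toAlgHom (ib b) = (sndCoord (L := L) n k₀).ampl (σ b) :=
    fun b => DFunLike.congr_fun hρB b
  have hs := fstCoord_isGraded n k₀ l₀
  have ht := sndCoord_isGraded n k₀ l₀
  let ω : (Fin (n + 1) → K) × (Fin (n + 1) → L) := (fun _ => k₀, fun _ => l₀)
  have hsupp := (orbitSupported_altProd ρ.toAlgHom ω hs ht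
    (by rintro _ ⟨a, rfl⟩; exact ⟨_, hA' a⟩) (by rintro _ ⟨b, rfl⟩; exact ⟨_, hB' b⟩)
    (wordLevel_const n k₀) (wordLevel_const n l₀) n).2 q hq
  refine (topDetected_altProd ρ.toAlgHom ω hs ht (columnRecovers_map hA' h1V hπ le_sup_left)
    (columnRecovers_map hB' h1W hσ le_sup_right) (LinearMap.map_le_range.trans le_sup_left)
    (LinearMap.map_le_range.trans le_sup_right) (wordLevel_const n k₀) (wordLevel_const n l₀)
    le_rfl).1 p hpVW fun x hx hx' => ?_
  have hsum : vacuumOrbit ρ.toAlgHom ω (p + q) = 0 := by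
    change (ρ (p + q)).mulVec _ = 0
    rw [h0, Matrix.zero_mulVec]
  have hqx : vacuumOrbit ρ.toAlgHom ω q x = 0 := by
    by_contra hne
    have := (hsupp x hne).2
    obtain rfl : n = 0 := by omega
    rw [hn rfl, map_zero] at hne
    exact hne rfl
  have := congrFun hsum x
  rwa [map_add, Pi.add_apply, hqx, add_zero] at this

end Coproduct

/-- the coproduct (free product) of two RFD unital *-algebras over ℂ is RFD. -/
theorem rfd_of_coproduct_of_rfd
    (A B C : Type)
    [Ring A] [Algebra ℂ A] [StarRing A] [StarModule ℂ A]
    [Ring B] [Algebra ℂ B] [StarRing B] [StarModule ℂ B]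
    [Ring C] [Algebra ℂ C] [StarRing C] [StarModule ℂ C]
    (ia : A →⋆ₐ[ℂ] C) (ib : B →⋆ₐ[ℂ] C) (hC : IsStarAlgCoproduct ia ib)
    (hA : IsRFD A) (hB : IsRFD B) :
    IsRFD C := by
  intro c hc
  have hC01 : (0 : C) ≠ 1 := fun h => hc (by rw [← mul_one c, ← h, mul_zero])
  have : Nontrivial A := ⟨0, 1, fun h => hC01 (by simpa using congrArg ia h)⟩
  have : Nontrivial B := ⟨0, 1, fun h => hC01 (by simpa using congrArg ib h)⟩
  suffices H : ∃ (X : Type) (_ : Fintype X) (_ : DecidableEq X) (ρ : C →⋆ₐ[ℂ] Matrix X X ℂ),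
      ρ c ≠ 0 by
    obtain ⟨X, _, _, ρ, hρ⟩ := H
    exact ⟨_, ρ.reindexFin, StarAlgHom.reindexFin_ne_zero hρ⟩
  classical
  have hex := hC.exists_mem_pow c
  have hmin : ∀ k < Nat.find hex, c ∉ (ia.rangeSubmodule ⊔ ib.rangeSubmodule) ^ k :=
    fun k hk => Nat.find_min hex hk
  have hmem := Nat.find_spec hex
  generalize Nat.find hex = n at hmin hmem
  cases n with
  | zero =>
    rw [← add_zero c]
    refine hC.exists_hom_ne_zero hA hB (n := 0) ?_ (zero_mem _) (fun _ => rfl) hc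
    simpa [altProd_zero] using hmem
  | succ n =>
    have hsup := sup_pow_le_altProd ia.one_mem_rangeSubmodule ib.one_mem_rangeSubmodule
      ia.rangeSubmodule_mul_self_le ib.rangeSubmodule_mul_self_le (n + 1) hmem
    obtain ⟨p, hp, q, hq, rfl⟩ := Submodule.mem_sup.1 hsup
    by_cases hpU : p ∈ (ia.rangeSubmodule ⊔ ib.rangeSubmodule) ^ n
    · have hqU : q ∉ (ia.rangeSubmodule ⊔ ib.rangeSubmodule) ^ n := fun h =>
        hmin n n.lt_succ_self (add_mem hpU h)
      rw [sup_comm] at hqU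
      rw [add_comm]
      exact hC.symm.exists_hom_ne_zero hB hA hq hp (by simp) hqU
    · exact hC.exists_hom_ne_zero hA hB hp hq (by simp) hpU
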